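/- For real x ≥ 2 and any ε > 0, the partial sum Σ_{nm ≤ x} Λ(n)d(m) satisfies: under the Riemann Hypothesis, Σ_{nm ≤ x} Λ(n)d(m) = (x/2)(log x)² + (γ₀ − 1)x·log x + (1 − γ₀)x + O(x^{1/2+ε}), arising as the residue at s = 1 of −(ζ'/ζ)(s)·ζ(s)²·x^s/s; in particular, the residue at s = 1 of −(ζ'/ζ)(s)·ζ(s)²·x^s/s equals (x/2)(log x)² + (γ₀ − 1)x·log x + (1 − γ₀)x. -/

import Mathlib

open Filter Asymptotics ArithmeticFunction

lemma aux_residue (x : ℝ) (hx : 0 < x) (r : ℝ) (hr : 0 < r) (hr1 : r < 1) :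
    (2 * Real.pi * Complex.I)⁻¹ *
              (∮ s in C(1, r),
                -(deriv riemannZeta s / riemannZeta s) * riemannZeta s ^ 2 * (x : ℂ) ^ s / s)
            = ((x / 2) * Real.log x ^ 2
                + (Real.eulerMascheroniConstant - 1) * x * Real.log x
                + (1 - Real.eulerMascheroniConstant) * x : ℝ) := by
  have hxc : (x : ℂ) ≠ 0 := by exact_mod_cast hx.ne'
  set l : ℂ := Complex.log x with hl
  have hlr : l = (Real.log x : ℂ) := by rw [hl, Complex.ofReal_log hx.le]
  have hpow : ∀ s : ℂ, HasDerivAt (fun s : ℂ => (x : ℂ) ^ s) ((x : ℂ) ^ s * l) s := by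
    intro s
    simpa using (hasDerivAt_id s).const_cpow (c := (x : ℂ)) (Or.inl hxc)
  let φ : ℂ → ℂ := fun s => (x : ℂ) ^ s * s⁻¹
  let φ' : ℂ → ℂ := fun s => (x : ℂ) ^ s * l * s⁻¹ + (x : ℂ) ^ s * (-(s ^ 2)⁻¹)
  have hφ : ∀ s : ℂ, s ≠ 0 → HasDerivAt φ (φ' s) s := fun s hs =>
    (hpow s).mul (hasDerivAt_inv hs)
  have hφ' : ∀ s : ℂ, s ≠ 0 → HasDerivAt φ' (((x : ℂ) ^ s * l * l) * s⁻¹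
      + (x : ℂ) ^ s * l * (-(s ^ 2)⁻¹) + ((x : ℂ) ^ s * l * (-(s ^ 2)⁻¹)
      + (x : ℂ) ^ s * (2 * s / (s ^ 2) ^ 2))) s := by
    intro s hs
    refine (((hpow s).mul_const l).mul (hasDerivAt_inv hs)).add ((hpow s).mul ?_)
    have h := ((hasDerivAt_pow 2 s).inv (pow_ne_zero 2 hs)).neg
    refine h.congr_deriv ?_
    simp
    ring
  let f : ℂ → ℂ := fun s => riemannZeta₁ s ^ 2 * φ' s / 2
  have hU : IsOpen ({0}ᶜ : Set ℂ) := isOpen_compl_singleton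
  have hsub : Metric.closedBall (1 : ℂ) r ⊆ {0}ᶜ := by
    intro z hz h0
    rw [Set.mem_singleton_iff] at h0
    subst h0
    simp at hz
    linarith
  have hf : DifferentiableOn ℂ f {0}ᶜ := by
    intro s hs
    have h1 := (hφ' s hs).differentiableAt
    have h2 : DifferentiableAt ℂ riemannZeta₁ s := differentiable_riemannZeta₁ s
    exact (((h2.pow 2).mul h1).div_const 2).differentiableWithinAt
  have hC := Complex.two_pi_I_inv_smul_circleIntegral_sub_sq_inv_smul_of_differentiable hU hsub hf
    (Metric.mem_ball_self hr)
  have hsph : ∀ s ∈ Metric.sphere (1 : ℂ) r, s ≠ 0 ∧ s ≠ 1 := by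
    intro s hs
    refine ⟨fun h => hsub (Metric.sphere_subset_closedBall hs) h, ?_⟩
    rintro rfl
    simp at hs
    linarith
  have hz0 := circleIntegral.integral_eq_zero_of_hasDerivWithinAt (c := (1 : ℂ)) (R := r)
    (f := fun s => riemannZeta s ^ 2 * φ s / 2)
    (f' := fun s => (2 * riemannZeta s * deriv riemannZeta s * φ s
      + riemannZeta s ^ 2 * φ' s) / 2) hr.le (by
    intro s hs
    obtain ⟨h0, h1⟩ := hsph s hs
    have h2 := (differentiableAt_riemannZeta h1).hasDerivAt
    have h3 := (((h2.pow 2).mul (hφ s h0)).div_const 2).hasDerivWithinAt (s := Metric.sphere 1 r)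
    refine h3.congr_deriv ?_
    simp)
  have hd : deriv f 1 = ((x / 2) * Real.log x ^ 2
                + (Real.eulerMascheroniConstant - 1) * x * Real.log x
                + (1 - Real.eulerMascheroniConstant) * x : ℝ) := by
    have h2 : HasDerivAt riemannZeta₁ _ 1 := (differentiable_riemannZeta₁ 1).hasDerivAt
    have h3 := (((h2.pow 2).mul (hφ' 1 one_ne_zero)).div_const 2).deriv
    change deriv f 1 = _ at h3
    rw [h3]
    simp [φ', hlr]
    ring
  rw [← hd, ← hC, smul_eq_mul]
  congr 1
  symm
  rw [← sub_zero (circleIntegral _ _ _), ← hz0, ← circleIntegral.integral_sub]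
  rotate_left
  · refine ContinuousOn.circleIntegrable hr.le ?_
    simp only [smul_eq_mul]
    refine ContinuousOn.mul ?_ ?_
    · refine ContinuousOn.inv₀ (by fun_prop) fun s hs => ?_
      exact pow_ne_zero 2 (sub_ne_zero.mpr (hsph s hs).2)
    · exact hf.continuousOn.mono (Metric.sphere_subset_closedBall.trans hsub)
  · refine ContinuousOn.circleIntegrable hr.le ?_
    have e0 : ContinuousOn riemannZeta (Metric.sphere 1 r) := fun s hs =>
      (differentiableAt_riemannZeta (hsph s hs).2).continuousAt.continuousWithinAt
    have e1 : ContinuousOn (deriv riemannZeta) (Metric.sphere 1 r) :=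
      (differentiableOn_riemannZeta.deriv isOpen_compl_singleton).continuousOn.mono
        fun s hs => (hsph s hs).2
    have e2 : ContinuousOn φ (Metric.sphere 1 r) := fun s hs =>
      (hφ s (hsph s hs).1).continuousAt.continuousWithinAt
    have e3 : ContinuousOn φ' (Metric.sphere 1 r) := fun s hs =>
      (hφ' s (hsph s hs).1).continuousAt.continuousWithinAt
    exact ((((continuousOn_const.mul e0).mul e1).mul e2).add ((e0.pow 2).mul e3)).div_const 2
  symm
  refine circleIntegral.integral_congr hr.le fun s hs => ?_
  obtain ⟨h0, h1⟩ := hsph s hs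
  have h2 := sub_ne_zero.mpr h1
  have h3 : -(deriv riemannZeta s / riemannZeta s) * riemannZeta s ^ 2
      = - (deriv riemannZeta s * riemannZeta s) := by
    by_cases h : riemannZeta s = 0
    · simp [h]
    · field_simp
  have h4 : riemannZeta₁ s ^ 2 = (s - 1) ^ 2 * riemannZeta s ^ 2 := by
    rw [riemannZeta_eq_inv_sub_mul h1]
    field_simp
  simp only [h3, f, φ, h4, smul_eq_mul]
  field_simp
  ring

noncomputable def auxL (n : ℕ) : ℝ := ∑ k ∈ Finset.Ioc 0 n, Real.log k

lemma auxL_succ (n : ℕ) : auxL (n + 1) = auxL n + Real.log (n + 1) := by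
  unfold auxL
  rw [Finset.sum_Ioc_succ_top (by omega)]
  push_cast; rfl

lemma aux_sum (N : ℕ) :
    ∑ p ∈ (Finset.Icc 1 N ×ˢ Finset.Icc 1 N).filter (fun p => p.1 * p.2 ≤ N),
            ArithmeticFunction.vonMangoldt p.1 * ((p.2).divisors.card : ℝ)
    = ∑ p ∈ (Finset.Ioc 0 N ×ˢ Finset.Ioc 0 N).filter (fun p => p.1 * p.2 ≤ N),
        Real.log p.1 := by
  have hI : Finset.Icc 1 N = Finset.Ioc 0 N := by ext; simp; omega
  rw [hI]
  have h1 := sum_Ioc_mul_eq_sum_prod_filter (R := ℝ) vonMangoldt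
    ((ArithmeticFunction.sigma 0 : ArithmeticFunction ℕ) : ArithmeticFunction ℝ) N
  have h2 := sum_Ioc_mul_eq_sum_prod_filter (R := ℝ) ArithmeticFunction.log
    ((ArithmeticFunction.zeta : ArithmeticFunction ℕ) : ArithmeticFunction ℝ) N
  have h3 : (vonMangoldt : ArithmeticFunction ℝ) *
    ((ArithmeticFunction.sigma 0 : ArithmeticFunction ℕ) : ArithmeticFunction ℝ)
    = ArithmeticFunction.log * ((ArithmeticFunction.zeta : ArithmeticFunction ℕ) : ArithmeticFunction ℝ) := by
    rw [← zeta_mul_pow_eq_sigma, pow_zero_eq_zeta, natCoe_mul, ← mul_assoc, vonMangoldt_mul_zeta]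
  rw [h3, h2] at h1
  simp only [natCoe_apply, sigma_zero_apply] at h1
  rw [← h1]
  refine Finset.sum_congr rfl fun p hp => ?_
  simp at hp
  have : p.2 ≠ 0 := by omega
  simp [zeta_apply, this, ArithmeticFunction.log_apply]

lemma aux_hyp (N M : ℕ) (h1 : M * M ≤ N) (h2 : N < (M + 1) * (M + 1)) :
    ∑ p ∈ (Finset.Ioc 0 N ×ˢ Finset.Ioc 0 N).filter (fun p => p.1 * p.2 ≤ N), Real.log p.1
    = ∑ a ∈ Finset.Ioc 0 M, Real.log a * ((N / a : ℕ) : ℝ) + ∑ b ∈ Finset.Ioc 0 M, auxL (N / b)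
      - M * auxL M := by
  have hMN : M ≤ N := by nlinarith
  have e1 : ∑ a ∈ Finset.Ioc 0 M, Real.log a * ((N / a : ℕ) : ℝ)
      = ∑ p ∈ Finset.Ioc 0 N ×ˢ Finset.Ioc 0 N, 
        if p.1 * p.2 ≤ N ∧ p.1 ≤ M then Real.log p.1 else 0 := by
    rw [← Finset.sum_filter]
    rw [Finset.sum_congr rfl (fun (a : ℕ) _ => show Real.log a * ((N / a : ℕ) : ℝ) =
      ∑ b ∈ Finset.Ioc 0 (N / a), Real.log a by simp [mul_comm])]
    rw [Finset.sum_sigma']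
    refine Finset.sum_bij' (fun p _ => (p.1, p.2)) (fun p _ => ⟨p.1, p.2⟩) ?_ ?_ ?_ ?_ ?_
    · rintro ⟨a, b⟩ h
      simp at h ⊢
      have := (Nat.le_div_iff_mul_le h.1.1).1 h.2.2
      have : b ≤ N := by nlinarith
      refine ⟨⟨⟨?_, ?_⟩, ?_, ?_⟩, ?_, ?_⟩ <;> first | omega | nlinarith
    · rintro ⟨a, b⟩ h
      simp at h ⊢
      exact ⟨⟨h.1.1.1, h.2.2⟩, h.1.2.1, (Nat.le_div_iff_mul_le h.1.1.1).2 (by nlinarith)⟩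
    · simp
    · simp
    · simp
  have e2 : ∑ b ∈ Finset.Ioc 0 M, auxL (N / b)
      = ∑ p ∈ Finset.Ioc 0 N ×ˢ Finset.Ioc 0 N, 
        if p.1 * p.2 ≤ N ∧ p.2 ≤ M then Real.log p.1 else 0 := by
    rw [← Finset.sum_filter]
    unfold auxL
    rw [Finset.sum_sigma']
    refine Finset.sum_bij' (fun p _ => (p.2, p.1)) (fun p _ => ⟨p.2, p.1⟩) ?_ ?_ ?_ ?_ ?_
    · rintro ⟨a, b⟩ h
      simp at h ⊢
      have := (Nat.le_div_iff_mul_le h.1.1).1 h.2.2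
      have : b ≤ N := by nlinarith
      refine ⟨⟨⟨?_, ?_⟩, ?_, ?_⟩, ?_, ?_⟩ <;> first | omega | nlinarith
    · rintro ⟨a, b⟩ h
      simp at h ⊢
      exact ⟨⟨h.1.2.1, h.2.2⟩, h.1.1.1, (Nat.le_div_iff_mul_le h.1.2.1).2 (by nlinarith)⟩
    · simp
    · simp
    · simp
  have e3 : M * auxL M
      = ∑ p ∈ Finset.Ioc 0 N ×ˢ Finset.Ioc 0 N, 
        if p.1 ≤ M ∧ p.2 ≤ M then Real.log p.1 else 0 := by
    rw [← Finset.sum_filter]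
    have : (Finset.Ioc 0 N ×ˢ Finset.Ioc 0 N).filter (fun p => p.1 ≤ M ∧ p.2 ≤ M)
      = Finset.Ioc 0 M ×ˢ Finset.Ioc 0 M := by
      ext ⟨a, b⟩; simp; omega
    rw [this, Finset.sum_product]
    simp [auxL, Finset.mul_sum]
  rw [e1, e2, e3, Finset.sum_filter, ← Finset.sum_add_distrib, ← Finset.sum_sub_distrib]
  refine Finset.sum_congr rfl ?_
  rintro ⟨a, b⟩ h
  simp only
  by_cases ha : a ≤ M <;> by_cases hb : b ≤ M
  · have : a * b ≤ N := by nlinarith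
    simp [ha, hb, this]
  · simp [ha, hb]
  · simp [ha, hb]
  · have : ¬ a * b ≤ N := by nlinarith
    simp [ha, hb, this]

lemma auxL_lower (n : ℕ) (hn : 1 ≤ n) : n * Real.log n - n ≤ auxL n := by
  induction n, hn using Nat.le_induction with
  | base => simp [auxL]
  | succ n hn ih =>
    rw [auxL_succ]
    have hn0 : (0:ℝ) < n := by exact_mod_cast hn
    have h := Real.log_le_sub_one_of_pos (show (0:ℝ) < (n + 1) / n by positivity)
    rw [Real.log_div (by positivity) (by positivity)] at h
    have h' : (n:ℝ) * (Real.log (n+1) - Real.log n) ≤ 1 := by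
      calc _ ≤ (n:ℝ) * ((n+1)/n - 1) := by gcongr
        _ = 1 := by field_simp; ring
    push_cast
    linarith

lemma auxL_upper (n : ℕ) (hn : 1 ≤ n) : auxL n ≤ n * Real.log n - n + 1 + Real.log n := by
  induction n, hn using Nat.le_induction with
  | base => simp [auxL]
  | succ n hn ih =>
    rw [auxL_succ]
    have hn0 : (0:ℝ) < n := by exact_mod_cast hn
    have h := Real.log_le_sub_one_of_pos (show (0:ℝ) < n / (n + 1) by positivity)
    rw [Real.log_div (by positivity) (by positivity)] at h
    have h' : ((n:ℝ) + 1) * (Real.log n - Real.log (n+1)) ≤ -1 := by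
      calc _ ≤ ((n:ℝ)+1) * (n/(n+1) - 1) := by gcongr
        _ = -1 := by field_simp; ring
    push_cast
    linarith

lemma auxL_nonneg (n : ℕ) : 0 ≤ auxL n :=
  Finset.sum_nonneg fun k _ => Real.log_natCast_nonneg k

lemma auxL_real (t : ℝ) (ht : 1 ≤ t) :
    |auxL ⌊t⌋₊ - (t * Real.log t - t)| ≤ 2 * Real.log t + 2 := by
  have h1 : 1 ≤ ⌊t⌋₊ := Nat.le_floor (by simpa using ht)
  have hl := auxL_lower _ h1
  have hu := auxL_upper _ h1
  have hf := Nat.floor_le (show 0 ≤ t by linarith)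
  have hf' := Nat.lt_floor_add_one t
  have hn : (1:ℝ) ≤ (⌊t⌋₊ : ℝ) := by exact_mod_cast h1
  set n : ℝ := (⌊t⌋₊ : ℝ)
  have hlog : Real.log n ≤ Real.log t := Real.log_le_log (by linarith) hf
  have hlog0 : 0 ≤ Real.log n := Real.log_nonneg hn
  have h := Real.log_le_sub_one_of_pos (show (0:ℝ) < t / n by positivity)
  rw [Real.log_div (by positivity) (by positivity)] at h
  have h' : n * (Real.log t - Real.log n) ≤ t - n := by
    calc _ ≤ n * (t/n - 1) := by gcongr
      _ = t - n := by field_simp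
  rw [abs_le]
  constructor
  · nlinarith
  · nlinarith

lemma aux_harm (y : ℝ) (hy : 1 ≤ y) :
    |∑ b ∈ Finset.Ioc 0 ⌊y⌋₊, (b:ℝ)⁻¹ - (Real.log y + Real.eulerMascheroniConstant)| ≤ 2 / y := by
  have h1 : 1 ≤ ⌊y⌋₊ := Nat.le_floor (by simpa using hy)
  have hf := Nat.floor_le (show 0 ≤ y by linarith)
  have hf' := Nat.lt_floor_add_one y
  have hl := Real.eulerMascheroniSeq_lt_eulerMascheroniConstant ⌊y⌋₊
  have hu := Real.eulerMascheroniConstant_lt_eulerMascheroniSeq' ⌊y⌋₊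
  have hH : ((harmonic ⌊y⌋₊ : ℚ) : ℝ) = ∑ b ∈ Finset.Ioc 0 ⌊y⌋₊, (b:ℝ)⁻¹ := by
    generalize ⌊y⌋₊ = m
    induction m with
    | zero => simp
    | succ m ih =>
      rw [harmonic_succ, Finset.sum_Ioc_succ_top (by omega), ← ih]
      push_cast; rfl
  rw [Real.eulerMascheroniSeq, hH] at hl
  rw [Real.eulerMascheroniSeq', if_neg (by omega), hH] at hu
  have hn : (1:ℝ) ≤ (⌊y⌋₊ : ℝ) := by exact_mod_cast h1
  set n : ℝ := (⌊y⌋₊ : ℝ)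
  have hlog : Real.log n ≤ Real.log y := Real.log_le_log (by linarith) hf
  have hlog' : Real.log y ≤ Real.log (n+1) := Real.log_le_log (by linarith) hf'.le
  have h := Real.log_le_sub_one_of_pos (show (0:ℝ) < (n+1) / n by positivity)
  rw [Real.log_div (by positivity) (by positivity)] at h
  have h' : (n+1)/n - 1 ≤ 2 / y := by
    rw [show (n+1)/n - 1 = 1/n by field_simp; ring]
    rw [div_le_div_iff₀ (by linarith) (by linarith)]
    linarith
  rw [abs_le]
  constructor <;> linarith

set_option maxHeartbeats 1000000 in
lemma aux_main (x : ℝ) (hx : 1 ≤ x) :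
    |(∑ p ∈ (Finset.Icc 1 ⌊x⌋₊ ×ˢ Finset.Icc 1 ⌊x⌋₊).filter
              (fun p => p.1 * p.2 ≤ ⌊x⌋₊),
            ArithmeticFunction.vonMangoldt p.1 * ((p.2).divisors.card : ℝ))
          - ((x / 2) * Real.log x ^ 2
              + (Real.eulerMascheroniConstant - 1) * x * Real.log x
              + (1 - Real.eulerMascheroniConstant) * x)| ≤ 10 * (√x * (Real.log x + 1)) := by
  set y := √x with hy
  have hy0 : 0 ≤ y := Real.sqrt_nonneg x
  have hyy : y * y = x := Real.mul_self_sqrt (by linarith)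
  have hy1 : 1 ≤ y := by rw [hy]; exact Real.one_le_sqrt.mpr hx
  have hlogy : Real.log x = 2 * Real.log y := by
    rw [← hyy, Real.log_mul (by positivity) (by positivity)]; ring
  have hly0 : 0 ≤ Real.log y := Real.log_nonneg hy1
  have hMf := Nat.floor_le hy0
  have hMf' := Nat.lt_floor_add_one y
  have hM1 : 1 ≤ ⌊y⌋₊ := Nat.le_floor (by simpa using hy1)
  have hh := aux_harm y hy1
  have hLM := auxL_real y hy1
  have hLM0 := auxL_nonneg ⌊y⌋₊
  rw [aux_sum, aux_hyp ⌊x⌋₊ ⌊y⌋₊]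
  rotate_left
  · refine Nat.le_floor ?_
    push_cast
    rw [← hyy]
    gcongr
  · rw [Nat.floor_lt (by linarith)]
    push_cast
    rw [← hyy]
    gcongr
  set M := ⌊y⌋₊ with hM
  set H := ∑ b ∈ Finset.Ioc 0 M, (b:ℝ)⁻¹ with hH
  set K := ∑ b ∈ Finset.Ioc 0 M, Real.log b * (b:ℝ)⁻¹ with hK
  have hlb : ∀ a ∈ Finset.Ioc 0 M, (1:ℝ) ≤ a ∧ (a:ℝ) ≤ y ∧ 0 ≤ Real.log a ∧ Real.log a ≤ Real.log y := by
    intro a ha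
    rw [Finset.mem_Ioc] at ha
    have h1 : (1:ℝ) ≤ a := by exact_mod_cast ha.1
    have h2 : (a:ℝ) ≤ y := le_trans (by exact_mod_cast ha.2) hMf
    exact ⟨h1, h2, Real.log_nonneg h1, Real.log_le_log (by linarith) h2⟩
  have A1 : |∑ a ∈ Finset.Ioc 0 M, Real.log a * ((⌊x⌋₊ / a : ℕ) : ℝ) - x * K| ≤ y * Real.log y := by
    rw [hK, Finset.mul_sum, ← Finset.sum_sub_distrib]
    refine (Finset.abs_sum_le_sum_abs _ _).trans ?_
    refine (Finset.sum_le_card_nsmul _ _ (Real.log y) ?_).trans ?_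
    · intro a ha
      obtain ⟨h1, h2, h3, h4⟩ := hlb a ha
      rw [← Nat.floor_div_natCast]
      have h5 := Nat.floor_le (show 0 ≤ x / a by positivity)
      have h6 := Nat.lt_floor_add_one (x / a)
      rw [div_eq_mul_inv] at h5 h6
      rw [show Real.log a * (⌊x / a⌋₊ : ℝ) - x * (Real.log a * (a:ℝ)⁻¹)
        = Real.log a * ((⌊x / a⌋₊ : ℝ) - x * (a:ℝ)⁻¹) by ring, abs_mul, abs_of_nonneg h3]
      have h7 : |(⌊x / a⌋₊ : ℝ) - x * (a:ℝ)⁻¹| ≤ 1 := by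
        rw [div_eq_mul_inv, abs_le]; constructor <;> linarith
      nlinarith [abs_nonneg ((⌊x / a⌋₊ : ℝ) - x * (a:ℝ)⁻¹)]
    · simp only [Nat.card_Ioc, tsub_zero, nsmul_eq_mul]
      gcongr
  have A2 : |∑ b ∈ Finset.Ioc 0 M, auxL (⌊x⌋₊ / b) - (x * Real.log x * H - x * K - x * H)|
      ≤ y * (2 * Real.log x + 2) := by
    rw [hK, hH, Finset.mul_sum, Finset.mul_sum, Finset.mul_sum, ← Finset.sum_sub_distrib,
      ← Finset.sum_sub_distrib, ← Finset.sum_sub_distrib]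
    refine (Finset.abs_sum_le_sum_abs _ _).trans ?_
    refine (Finset.sum_le_card_nsmul _ _ (2 * Real.log x + 2) ?_).trans ?_
    · intro a ha
      obtain ⟨h1, h2, h3, h4⟩ := hlb a ha
      rw [← Nat.floor_div_natCast]
      have h5 := auxL_real (x / a) (by rw [le_div_iff₀ (by linarith)]; nlinarith)
      rw [Real.log_div (by positivity) (by positivity)] at h5
      rw [show x / a * (Real.log x - Real.log a) - x / a = x * Real.log x * (a:ℝ)⁻¹
        - x * (Real.log a * (a:ℝ)⁻¹) - x * (a:ℝ)⁻¹ by ring] at h5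
      linarith
    · simp only [Nat.card_Ioc, tsub_zero, nsmul_eq_mul]
      have : 0 ≤ Real.log x := Real.log_nonneg hx
      gcongr
  obtain ⟨E, hE⟩ : ∃ E, H = Real.log y + Real.eulerMascheroniConstant + E := ⟨_, (add_sub_cancel _ _).symm⟩
  obtain ⟨F, hF⟩ : ∃ F, auxL M = y * Real.log y - y + F := ⟨_, (add_sub_cancel _ _).symm⟩
  have hE' : |E| ≤ 2 / y := by rw [hE] at hh; simpa using hh
  have hF' : |F| ≤ 2 * Real.log y + 2 := by rw [hF] at hLM; simpa using hLM
  have A3 : |(x * Real.log x - x) * E| ≤ 2 * y * (Real.log x + 1) := by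
    have h0 : 0 ≤ Real.log x := Real.log_nonneg hx
    rw [abs_mul, show 2 * y * (Real.log x + 1) = (x * Real.log x + x) * (2 / y) by
      rw [← hyy]; field_simp]
    gcongr
    rw [abs_le]
    constructor <;> nlinarith
  have A4 : |M * auxL M - y * (y * Real.log y - y)| ≤ y * (3 * Real.log y + 2) + 
      2 * Real.log y + 2 := by
    have hM0 : (0:ℝ) ≤ M := Nat.cast_nonneg M
    have h1 : auxL M ≤ y * Real.log y + 2 * Real.log y + 2 := by
      rw [abs_le] at hF'
      linarith
    have h2 : M * auxL M - y * (y * Real.log y - y) = y * F - (y - M) * auxL M := by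
      rw [hF]; ring
    have h3 : |y * F| ≤ y * (2 * Real.log y + 2) := by
      rw [abs_mul, abs_of_nonneg hy0]; gcongr
    have h4 : 0 ≤ (y - M) * auxL M := mul_nonneg (by linarith) hLM0
    have h5 : (y - M) * auxL M ≤ auxL M := by nlinarith
    rw [h2]
    rw [abs_le] at h3 ⊢
    constructor <;> nlinarith
  rw [abs_le] at A1 A2 A3 A4 ⊢
  have key : x * Real.log x * H - x * K - x * H + x * K - y * (y * Real.log y - y)
     = (x / 2) * Real.log x ^ 2
              + (Real.eulerMascheroniConstant - 1) * x * Real.log x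
              + (1 - Real.eulerMascheroniConstant) * x + (x * Real.log x - x) * E := by
    rw [hE, hlogy, ← hyy]; ring
  have hb : y * Real.log y + y * (2 * Real.log x + 2) + 2 * y * (Real.log x + 1)
     + (y * (3 * Real.log y + 2) + 2 * Real.log y + 2) ≤ 10 * (y * (Real.log x + 1)) := by
    rw [hlogy]
    have h1 : Real.log y ≤ y * Real.log y := le_mul_of_one_le_left hly0 hy1
    linarith
  constructor <;> linarith

theorem stmt_17 (hRH : RiemannHypothesis) :
    (∀ ε : ℝ, 0 < ε →
      (fun x : ℝ =>
          (∑ p ∈ (Finset.Icc 1 ⌊x⌋₊ ×ˢ Finset.Icc 1 ⌊x⌋₊).filter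
              (fun p => p.1 * p.2 ≤ ⌊x⌋₊),
            ArithmeticFunction.vonMangoldt p.1 * ((p.2).divisors.card : ℝ))
          - ((x / 2) * Real.log x ^ 2
              + (Real.eulerMascheroniConstant - 1) * x * Real.log x
              + (1 - Real.eulerMascheroniConstant) * x))
        =O[atTop] (fun x : ℝ => x ^ ((1 : ℝ) / 2 + ε)))
    ∧ ∀ x : ℝ, 0 < x →
        ∃ ε > (0 : ℝ), ∀ r : ℝ, 0 < r → r < ε →
          (2 * Real.pi * Complex.I)⁻¹ *
              (∮ s in C(1, r),
                -(deriv riemannZeta s / riemannZeta s) * riemannZeta s ^ 2 * (x : ℂ) ^ s / s)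
            = ((x / 2) * Real.log x ^ 2
                + (Real.eulerMascheroniConstant - 1) * x * Real.log x
                + (1 - Real.eulerMascheroniConstant) * x : ℝ) := by
  refine ⟨fun ε hε => ?_, fun x hx => ⟨1, one_pos, fun r hr hr1 => aux_residue x hx r hr hr1⟩⟩
  have h1 : (fun x : ℝ => Real.log x + 1) =O[atTop] (fun x : ℝ => x ^ ε) := by
    refine (isLittleO_log_rpow_atTop hε).isBigO.add ?_
    refine IsBigO.of_bound 1 ?_
    filter_upwards [eventually_ge_atTop 1] with x hx
    rw [norm_one, one_mul, Real.norm_of_nonneg (by positivity)]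
    exact Real.one_le_rpow hx hε.le
  have h2 : (fun x : ℝ => x ^ ((1 : ℝ) / 2) * (Real.log x + 1)) =O[atTop]
      (fun x : ℝ => x ^ ((1 : ℝ) / 2 + ε)) := by
    refine ((isBigO_refl (fun x : ℝ => x ^ ((1 : ℝ) / 2)) atTop).mul h1).congr' EventuallyEq.rfl ?_
    filter_upwards [eventually_gt_atTop 0] with x hx
    rw [Real.rpow_add hx]
  refine IsBigO.trans (IsBigO.of_bound 10 ?_) h2
  filter_upwards [eventually_ge_atTop 1] with x hx
  rw [← Real.sqrt_eq_rpow, Real.norm_eq_abs, Real.norm_of_nonneg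
    (mul_nonneg (Real.sqrt_nonneg x) (by linarith [Real.log_nonneg hx]))]
  exact aux_main x hx
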